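/- arXiv:1903.05494 — 5 statements merged into one kernel-verified Lean document; each statement's English description precedes it below -/
import Mathlib

section
/- Let C_1, ..., C_s ⊆ F_q^n be linear codes with minimum distances d_1, ..., d_s, and let A ∈ F_q^{s×l} be a matrix of rank s. For each i, let D_i denote the minimum distance of the linear code C_{A_i} ⊆ F_q^l spanned by the first i rows of A. Then the minimum distance of the matrix-product code C = [C_1, ..., C_s]A satisfies d(C) ≥ min{D_1 d_1, D_2 d_2, ..., D_s d_s}. -/
open scoped Pointwise

/-- Hamming weight of a vector. -/
noncomputable def wt {ι F : Type*} [Fintype ι] [Zero F] (x : ι → F) : ℕ :=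
  letI := Classical.decEq F
  (Finset.univ.filter fun i => x i ≠ 0).card

/-- Minimum distance (= minimum weight) of a code given as a set. -/
noncomputable def minDist {ι F : Type*} [Fintype ι] [Zero F] (C : Set (ι → F)) : ℕ :=
  sInf (wt '' {x ∈ C | x ≠ 0})

/-- The matrix-product code `[C_1, …, C_s]A`, a subspace of `F^{l·n}`: the codeword
corresponding to `(c_1,…,c_s)` has `(j,k)` entry `∑ i, A i j * (c i) k`. -/
noncomputable def matrixProdCode {F : Type*} [Field F] {n s l : ℕ}
    (C : Fin s → Submodule F (Fin n → F)) (A : Matrix (Fin s) (Fin l) F) :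
    Submodule F (Fin l × Fin n → F) :=
  Submodule.map
    (show (Fin s → Fin n → F) →ₗ[F] (Fin l × Fin n → F) from
      { toFun := fun c (jk : Fin l × Fin n) => ∑ i, A i jk.1 * c i jk.2
        map_add' := by
          intro a b; funext jk
          simp [mul_add, Finset.sum_add_distrib]
        map_smul' := by
          intro r a; funext jk
          simp [Finset.mul_sum, mul_left_comm] })
    (Submodule.pi Set.univ C)

theorem minDist_le_wt {ι F : Type*} [Fintype ι] [Zero F] {C : Set (ι → F)} {x : ι → F}
    (hx : x ∈ C) (hx0 : x ≠ 0) : minDist C ≤ wt x :=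
  Nat.sInf_le ⟨x, ⟨hx, hx0⟩, rfl⟩

theorem exists_wt_eq_minDist {ι F : Type*} [Fintype ι] [Zero F] {C : Set (ι → F)}
    (h : ∃ x ∈ C, x ≠ 0) : ∃ x ∈ C, x ≠ 0 ∧ wt x = minDist C := by
  obtain ⟨x, hx, hx0⟩ := h
  obtain ⟨y, ⟨hy, hy0⟩, hyw⟩ :=
    Nat.sInf_mem (s := wt '' {x ∈ C | x ≠ 0}) ⟨wt x, x, ⟨hx, hx0⟩, rfl⟩
  exact ⟨y, hy, hy0, hyw⟩

theorem minDist_eq_zero {ι F : Type*} [Fintype ι] [Zero F] {C : Set (ι → F)}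
    (h : ∀ x ∈ C, x = 0) : minDist C = 0 := by
  have : {x ∈ C | x ≠ 0} = ∅ :=
    Set.eq_empty_of_forall_notMem fun x hx => hx.2 (h x hx.1)
  simp [minDist, this]

theorem wt_prod {ι κ F : Type*} [Fintype ι] [Fintype κ] [Zero F] (w : ι × κ → F) :
    wt w = ∑ k, wt fun j => w (j, k) := by
  classical
  simp only [wt, Finset.card_filter]
  rw [Fintype.sum_prod_type_right]

theorem mul_wt_le_wt_prod {ι κ F : Type*} [Fintype ι] [Fintype κ] [Zero F] {D : ℕ}
    {w : ι × κ → F} {x : κ → F} (h : ∀ k, x k ≠ 0 → D ≤ wt fun j => w (j, k)) :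
    D * wt x ≤ wt w := by
  classical
  rw [wt_prod, wt, Finset.card_filter, Finset.mul_sum]
  refine Finset.sum_le_sum fun k _ => ?_
  by_cases hk : x k = 0
  · simp [hk]
  · simpa [hk] using h k hk

theorem Matrix.linearIndependent_row_of_rank_eq_card {m n F : Type*} [Fintype m] [Fintype n]
    [Field F] {A : Matrix m n F} (hA : A.rank = Fintype.card m) :
    LinearIndependent F A.row := by
  rw [linearIndependent_iff_card_eq_finrank_span, ← hA, Matrix.rank_eq_finrank_span_row]
  rfl

theorem mem_matrixProdCode {F : Type*} [Field F] {n s l : ℕ}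
    {C : Fin s → Submodule F (Fin n → F)} {A : Matrix (Fin s) (Fin l) F}
    {w : Fin l × Fin n → F} :
    w ∈ matrixProdCode C A ↔
      ∃ c : Fin s → Fin n → F, (∀ i, c i ∈ C i) ∧
        (fun jk : Fin l × Fin n => ∑ i, A i jk.1 * c i jk.2) = w := by
  simp only [matrixProdCode, Submodule.mem_map, Submodule.mem_pi, Set.mem_univ, true_imp_iff]
  rfl

theorem column_ne_zero {F : Type*} [Field F] {n s l : ℕ} {A : Matrix (Fin s) (Fin l) F}
    (hA : LinearIndependent F A.row) {c : Fin s → Fin n → F} {i : Fin s} {k : Fin n}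
    (h : c i k ≠ 0) : (fun j => ∑ r, A r j * c r k) ≠ 0 := by
  intro h0
  refine h (Fintype.linearIndependent_iff.1 hA (fun r => c r k) ?_ i)
  rw [← h0]
  ext j
  simp [Matrix.row, mul_comm]

theorem column_mem_span {F : Type*} [Field F] {n s l : ℕ} {A : Matrix (Fin s) (Fin l) F}
    {c : Fin s → Fin n → F} {i : Fin s} (h : ∀ r, i < r → c r = 0) (k : Fin n) :
    (fun j => ∑ r, A r j * c r k) ∈
      Submodule.span F {v : Fin l → F | ∃ r : Fin s, (r : ℕ) ≤ (i : ℕ) ∧ v = A r} := by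
  have he : (fun j => ∑ r, A r j * c r k) = ∑ r, c r k • A r := by
    ext j
    simp [mul_comm]
  rw [he]
  refine Submodule.sum_mem _ fun r _ => ?_
  rcases le_or_gt r i with hr | hr
  · exact Submodule.smul_mem _ _ (Submodule.subset_span ⟨r, hr, rfl⟩)
  · simp [h r hr]

theorem exists_last_ne_zero {s : ℕ} {M : Type*} [Zero M] {c : Fin s → M} (h : c ≠ 0) :
    ∃ i, c i ≠ 0 ∧ ∀ r, i < r → c r = 0 := by
  classical
  obtain ⟨a, ha⟩ := Function.ne_iff.1 h
  obtain ⟨i, hi, hmax⟩ := (Finset.univ.filter fun i => c i ≠ 0).exists_max_image id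
    ⟨a, by simpa using ha⟩
  refine ⟨i, by simpa using hi, fun r hr => ?_⟩
  by_contra hc
  exact (hmax r (by simpa using hc)).not_gt hr

/-- If `D_i` is the minimum distance of the code spanned by the first
`i` rows of `A` (a rank-`s` matrix) and `d_i = d(C_i)`, then the matrix-product code
`C = [C_1,…,C_s]A` satisfies `d(C) ≥ min_i D_i d_i`. -/
theorem matrixProdCode_minDist_ge
    {F : Type*} [Field F] [Fintype F] {n s l : ℕ} (hs : 0 < s)
    (C : Fin s → Submodule F (Fin n → F))
    (A : Matrix (Fin s) (Fin l) F) (hA : A.rank = s) :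
    ⨅ i : Fin s,
        minDist ((Submodule.span F {v : Fin l → F | ∃ r : Fin s, (r : ℕ) ≤ (i : ℕ) ∧ v = A r} :
            Submodule F (Fin l → F)) : Set (Fin l → F)) *
          minDist (C i : Set (Fin n → F))
      ≤ minDist (matrixProdCode C A : Set (Fin l × Fin n → F)) := by
  have hind : LinearIndependent F A.row :=
    Matrix.linearIndependent_row_of_rank_eq_card (by simpa using hA)
  by_cases hne : ∃ w ∈ (matrixProdCode C A : Set (Fin l × Fin n → F)), w ≠ 0
  · obtain ⟨w, hw, hw0, hwt⟩ := exists_wt_eq_minDist hne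
    obtain ⟨c, hc, rfl⟩ := mem_matrixProdCode.1 hw
    have hc0 : c ≠ 0 := by
      rintro rfl
      exact hw0 (by ext; simp)
    obtain ⟨i, hi, hlast⟩ := exists_last_ne_zero hc0
    rw [← hwt]
    refine (ciInf_le (OrderBot.bddBelow _) i).trans ?_
    refine (Nat.mul_le_mul_left _ (minDist_le_wt (hc i) hi)).trans ?_
    exact mul_wt_le_wt_prod fun k hk =>
      minDist_le_wt (column_mem_span hlast k) (column_ne_zero hind hk)
  · push Not at hne
    refine (ciInf_le (OrderBot.bddBelow _) (⟨0, hs⟩ : Fin s)).trans ?_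
    rw [minDist_eq_zero (C := (C ⟨0, hs⟩ : Set (Fin n → F))), mul_zero]
    · exact Nat.zero_le _
    intro x hx
    by_contra hx0
    obtain ⟨k, hk⟩ := Function.ne_iff.1 hx0
    have hmem : ∀ i, (Pi.single ⟨0, hs⟩ x : Fin s → Fin n → F) i ∈ C i := by
      intro i
      by_cases h : i = ⟨0, hs⟩
      · subst h
        simpa using hx
      · simp [Pi.single_eq_of_ne h]
    have hzero := hne _ (mem_matrixProdCode.2 ⟨_, hmem, rfl⟩)
    refine column_ne_zero (c := Pi.single ⟨0, hs⟩ x) (i := ⟨0, hs⟩) (k := k) hind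
      (by simpa using hk) ?_
    ext j
    exact congrFun hzero (j, k)
end

section
/- Let C_1, C_2, C_1', C_2' ⊆ F_q^n be linear codes, let A be the 2×2 matrix with rows (1,1) and (0,1) over F_q, and set C = [C_1, C_2]A and C' = [C_1', C_2']A. Then the componentwise (Schur) product of codes satisfies C * C' = [C_1*C_1', C_1*C_2' + C_2*C_1' + C_2*C_2']A. -/
open scoped Pointwise

/-- Componentwise (Schur) product of two codes. -/
def schurProd {F : Type*} [Field F] {ι : Type*} (C C' : Submodule F (ι → F)) :
    Submodule F (ι → F) :=
  Submodule.span F {x | ∃ c ∈ C, ∃ c' ∈ C', x = c * c'}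

/-- The linear map `(u, v) ↦ (u, u + v)`, with values indexed as in `matrixProdCode`. -/
def uuvMap (F : Type*) [Field F] (n : ℕ) :
    (Fin n → F) × (Fin n → F) →ₗ[F] (Fin 2 × Fin n → F) where
  toFun p jk := ![p.1, p.1 + p.2] jk.1 jk.2
  map_add' p q := by
    ext ⟨j, k⟩
    fin_cases j <;> simp [add_add_add_comm]
  map_smul' r p := by
    ext ⟨j, k⟩
    fin_cases j <;> simp [mul_add]

theorem uuvMap_mul {F : Type*} [Field F] {n : ℕ} (a b a' b' : Fin n → F) :
    uuvMap F n (a, b) * uuvMap F n (a', b') =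
      uuvMap F n (a * a', a * b' + b * a' + b * b') := by
  ext ⟨j, k⟩
  fin_cases j
  · simp [uuvMap]
  · simp [uuvMap]
    ring

theorem mul_mem_schurProd {F : Type*} [Field F] {ι : Type*} {C C' : Submodule F (ι → F)}
    {c c' : ι → F} (hc : c ∈ C) (hc' : c' ∈ C') : c * c' ∈ schurProd C C' :=
  Submodule.subset_span ⟨c, hc, c', hc', rfl⟩

theorem schurProd_le {F : Type*} [Field F] {ι : Type*} {C C' D : Submodule F (ι → F)} :
    schurProd C C' ≤ D ↔ ∀ c ∈ C, ∀ c' ∈ C', c * c' ∈ D := by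
  refine ⟨fun h c hc c' hc' => h (mul_mem_schurProd hc hc'), fun h => Submodule.span_le.2 ?_⟩
  rintro _ ⟨c, hc, c', hc', rfl⟩
  exact h c hc c' hc'

theorem matrixProdCode_uuv {F : Type*} [Field F] {n : ℕ} (D₁ D₂ : Submodule F (Fin n → F)) :
    matrixProdCode ![D₁, D₂] !![(1 : F), 1; 0, 1] = (D₁.prod D₂).map (uuvMap F n) := by
  have key (c : Fin 2 → Fin n → F) :
      (fun jk : Fin 2 × Fin n => ∑ i, !![(1 : F), 1; 0, 1] i jk.1 * c i jk.2) =
        uuvMap F n (c 0, c 1) := by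
    ext ⟨j, k⟩
    fin_cases j <;> simp [uuvMap, Fin.sum_univ_two]
  ext x
  constructor
  · rintro ⟨c, hc, rfl⟩
    exact ⟨(c 0, c 1), ⟨hc 0 trivial, hc 1 trivial⟩, (key c).symm⟩
  · rintro ⟨⟨a, b⟩, ⟨ha, hb⟩, rfl⟩
    refine ⟨![a, b], fun i _ => ?_, key ![a, b]⟩
    fin_cases i
    exacts [ha, hb]

/-- For `C = [C_1, C_2]A` and `C' = [C_1', C_2']A` with
`A = [[1,1],[0,1]]` (the `(u,u+v)`-construction), one has
`C * C' = [C_1*C_1', C_1*C_2' + C_2*C_1' + C_2*C_2']A`. -/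
theorem schurProd_uuv
    {F : Type*} [Field F] [Fintype F] {n : ℕ}
    (C₁ C₂ C₁' C₂' : Submodule F (Fin n → F)) :
    schurProd (matrixProdCode ![C₁, C₂] !![(1 : F), 1; 0, 1])
        (matrixProdCode ![C₁', C₂'] !![(1 : F), 1; 0, 1]) =
      matrixProdCode
        ![schurProd C₁ C₁', schurProd C₁ C₂' ⊔ schurProd C₂ C₁' ⊔ schurProd C₂ C₂']
        !![(1 : F), 1; 0, 1] := by
  simp only [matrixProdCode_uuv]
  apply le_antisymm
  · rw [schurProd_le]
    rintro _ ⟨⟨a, b⟩, ⟨ha, hb⟩, rfl⟩ _ ⟨⟨a', b'⟩, ⟨ha', hb'⟩, rfl⟩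
    rw [uuvMap_mul]
    exact Submodule.mem_map_of_mem ⟨mul_mem_schurProd ha ha',
      Submodule.add_mem_sup (Submodule.add_mem_sup (mul_mem_schurProd ha hb')
        (mul_mem_schurProd hb ha')) (mul_mem_schurProd hb hb')⟩
  · have key {a b a' b' : Fin n → F} (ha : a ∈ C₁) (hb : b ∈ C₂) (ha' : a' ∈ C₁')
        (hb' : b' ∈ C₂') :
        uuvMap F n (a * a', a * b' + b * a' + b * b') ∈
          schurProd ((C₁.prod C₂).map (uuvMap F n)) ((C₁'.prod C₂').map (uuvMap F n)) := by
      rw [← uuvMap_mul]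
      exact mul_mem_schurProd (Submodule.mem_map_of_mem ⟨ha, hb⟩)
        (Submodule.mem_map_of_mem ⟨ha', hb'⟩)
    rw [Submodule.map_le_iff_le_comap, Submodule.prod_le_iff]
    simp only [Submodule.map_le_iff_le_comap, sup_le_iff, schurProd_le]
    refine ⟨fun a ha a' ha' => ?_, ⟨fun a ha b' hb' => ?_, fun b hb a' ha' => ?_⟩,
      fun b hb b' hb' => ?_⟩
    · simpa using key ha C₂.zero_mem ha' C₂'.zero_mem
    · simpa using key ha C₂.zero_mem C₁'.zero_mem hb'
    · simpa using key C₁.zero_mem hb ha' C₂'.zero_mem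
    · simpa using key C₁.zero_mem hb C₁'.zero_mem hb'
end

section
/- Let n be coprime to q, and let I_1 and I_2 be unions of q-cyclotomic cosets modulo n, with corresponding cyclic codes C(I_1) and C(I_2) of length n over F_q. Then the componentwise (Schur) product satisfies C(I_1) * C(I_2) = C(I_1 + I_2), where I_1 + I_2 = {a + b mod n : a ∈ I_1, b ∈ I_2}. -/
open scoped Pointwise

/-- The cyclic code `C(I)` of length `n` over `F` with generating set `I` (where
`β` is a primitive `n`-th root of unity in the algebraic closure of `F`):
codewords are the coefficient vectors `c` whose polynomial `∑ c_k x^k` vanishes at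
`β^j` for every `j` outside `I`; equivalently, the code generated by
`g = (x^n-1)/∏_{i∈I}(x-β^i)`. -/
noncomputable def cyclicCode (F : Type*) [Field F] (n : ℕ) [NeZero n]
    (β : AlgebraicClosure F) (I : Set (ZMod n)) : Submodule F (Fin n → F) where
  carrier := {c | ∀ j : ZMod n, j ∉ I →
    ∑ k : Fin n, algebraMap F (AlgebraicClosure F) (c k) * β ^ (j * (k : ZMod n)).val = 0}
  zero_mem' := by intro j hj; simp
  add_mem' := by
    intro a b ha hb j hj
    simp only [Pi.add_apply, map_add, add_mul, Finset.sum_add_distrib, ha j hj, hb j hj,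
      add_zero]
  smul_mem' := by
    intro r c hc j hj
    simp only [Pi.smul_apply, smul_eq_mul, map_mul, mul_assoc, ← Finset.mul_sum, hc j hj,
      mul_zero]

section Codes

variable {F : Type*} [Field F]

lemma fin_natCast_zmod_injective (n : ℕ) :
    Function.Injective fun k : Fin n => (k : ZMod n) := fun k l h => by
  have h' := congrArg ZMod.val h
  simp only [ZMod.val_natCast, Nat.mod_eq_of_lt k.2, Nat.mod_eq_of_lt l.2] at h'
  exact Fin.ext h'

lemma sum_fin_natCast_zmod {M : Type*} [AddCommMonoid M] (n : ℕ) [NeZero n] (f : ZMod n → M) :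
    ∑ k : Fin n, f (k : ZMod n) = ∑ z : ZMod n, f z := by
  refine Fintype.sum_bijective (fun k : Fin n => (k : ZMod n))
    ⟨fin_natCast_zmod_injective n, fun z => ?_⟩ _ _ fun _ => rfl
  exact ⟨⟨z.val, z.val_lt⟩, by simp⟩

/-- Extension of scalars of vectors, as a ring homomorphism. -/
abbrev extendScalars (F : Type*) [Field F] (E : Type*) [Field E] [Algebra F E] (ι : Type*) :
    (ι → F) →+* (ι → E) :=
  (algebraMap F E).compLeft ι

/-- A subspace contains every vector lying in its extension of scalars. -/
lemma mem_of_extendScalars_mem_span {E : Type*} [Field E] [Algebra F E] {ι : Type*} [Fintype ι]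
    (D : Submodule F (ι → F)) {x : ι → F}
    (hx : extendScalars F E ι x ∈ Submodule.span E (extendScalars F E ι '' (D : Set (ι → F)))) :
    x ∈ D := by
  classical
  by_contra hxD
  obtain ⟨f, hfx, hfD⟩ := Submodule.exists_le_ker_of_notMem hxD
  let g : (ι → E) →ₗ[E] E := Fintype.linearCombination E fun k => algebraMap F E (f (Pi.single k 1))
  have hg : ∀ y, g (extendScalars F E ι y) = algebraMap F E (f y) := by
    intro y
    conv_rhs => rw [pi_eq_sum_univ' y]
    simp [g, Fintype.linearCombination_apply]
  have hker : Submodule.span E (extendScalars F E ι '' (D : Set (ι → F))) ≤ LinearMap.ker g := by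
    rw [Submodule.span_le]
    rintro _ ⟨y, hy, rfl⟩
    rw [SetLike.mem_coe, LinearMap.mem_ker, hg, LinearMap.mem_ker.mp (hfD hy), map_zero]
  have := hker hx
  rw [LinearMap.mem_ker, hg] at this
  exact hfx ((map_eq_zero _).mp this)

lemma mul_mem_span_schurProd {E : Type*} [Field E] [Algebra F E] {ι : Type*}
    {C C' : Submodule F (ι → F)} {v w : ι → E}
    (hv : v ∈ Submodule.span E (extendScalars F E ι '' (C : Set (ι → F))))
    (hw : w ∈ Submodule.span E (extendScalars F E ι '' (C' : Set (ι → F)))) :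
    v * w ∈ Submodule.span E (extendScalars F E ι '' (schurProd C C' : Set (ι → F))) := by
  have h := Submodule.mul_mem_mul hv hw
  rw [Submodule.span_mul_span] at h
  refine Submodule.span_mono ?_ h
  rintro _ ⟨_, ⟨c, hc, rfl⟩, _, ⟨c', hc', rfl⟩, rfl⟩
  exact ⟨c * c', Submodule.subset_span ⟨c, hc, c', hc', rfl⟩, map_mul _ _ _⟩

variable {n : ℕ}

/-- The vector `k ↦ ψ (-(a * k))`. -/
def charVector {E : Type*} [Field E] (ψ : AddChar (ZMod n) E) (a : ZMod n) : Fin n → E :=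
  fun k => ψ (-(a * (k : ZMod n)))

lemma charVector_add {E : Type*} [Field E] (ψ : AddChar (ZMod n) E) (a b : ZMod n) :
    charVector ψ (a + b) = charVector ψ a * charVector ψ b := by
  ext k
  simp only [charVector, Pi.mul_apply, ← AddChar.map_add_eq_mul]
  congr 1
  ring

variable [NeZero n]

lemma sum_charVector_mul {E : Type*} [Field E] {ψ : AddChar (ZMod n) E} (hψ : ψ.IsPrimitive)
    (a j : ZMod n) :
    ∑ k : Fin n, charVector ψ a k * ψ (j * (k : ZMod n)) = if a = j then (n : E) else 0 := by
  simp only [charVector, ← AddChar.map_add_eq_mul]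
  rw [sum_fin_natCast_zmod n (fun z => ψ (-(a * z) + j * z))]
  have h := AddChar.sum_mulShift (j - a) hψ
  simp only [ZMod.card, sub_eq_zero, eq_comm (a := j)] at h
  rw [Nat.cast_ite, Nat.cast_zero] at h
  rw [← h]
  refine Finset.sum_congr rfl fun z _ => ?_
  congr 1
  ring

/-- Fourier inversion. -/
lemma natCast_smul_eq_sum_charVector {E : Type*} [Field E] {ψ : AddChar (ZMod n) E}
    (hψ : ψ.IsPrimitive) (w : Fin n → E) :
    (n : E) • w = ∑ j : ZMod n, (∑ k : Fin n, w k * ψ (j * (k : ZMod n))) • charVector ψ j := by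
  ext l
  have hinj : ∀ k : Fin n, ((k : ZMod n) - (l : ZMod n) = 0) ↔ k = l := fun k =>
    sub_eq_zero.trans (fin_natCast_zmod_injective n).eq_iff
  simp only [Finset.sum_apply, Pi.smul_apply, smul_eq_mul, charVector, Finset.sum_mul]
  rw [Finset.sum_comm]
  have h : ∀ k : Fin n, ∑ j : ZMod n, w k * ψ (j * (k : ZMod n)) * ψ (-(j * (l : ZMod n))) =
      if k = l then w k * n else 0 := by
    intro k
    have h := AddChar.sum_mulShift ((k : ZMod n) - (l : ZMod n)) hψ
    simp only [ZMod.card, hinj] at h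
    rw [Nat.cast_ite, Nat.cast_zero] at h
    rw [← mul_zero (w k), ← mul_ite, ← h, Finset.mul_sum]
    refine Finset.sum_congr rfl fun j _ => ?_
    rw [mul_assoc, ← AddChar.map_add_eq_mul]
    congr 2
    ring
  simp only [h, Finset.sum_ite_eq', Finset.mem_univ, if_true]
  ring

variable {β : AlgebraicClosure F} (hβ : IsPrimitiveRoot β n)

lemma mem_cyclicCode_iff {I : Set (ZMod n)} {c : Fin n → F} :
    c ∈ cyclicCode F n β I ↔ ∀ j ∉ I,
      ∑ k : Fin n, extendScalars F (AlgebraicClosure F) (Fin n) c k *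
        AddChar.zmodChar n hβ.pow_eq_one (j * (k : ZMod n)) = 0 :=
  Iff.rfl

lemma cyclicCode_mem_span_charVector {I : Set (ZMod n)} {c : Fin n → F}
    (hc : c ∈ cyclicCode F n β I) :
    extendScalars F (AlgebraicClosure F) (Fin n) c ∈ Submodule.span (AlgebraicClosure F)
      (charVector (AddChar.zmodChar n hβ.pow_eq_one) '' I) := by
  have hn : (n : AlgebraicClosure F) ≠ 0 := hβ.neZero'.out
  rw [← Submodule.smul_mem_iff _ hn, natCast_smul_eq_sum_charVector
    (AddChar.zmodChar_primitive_of_primitive_root n hβ)]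
  refine Submodule.sum_mem _ fun j _ => ?_
  by_cases hj : j ∈ I
  · exact Submodule.smul_mem _ _ (Submodule.subset_span ⟨j, hj, rfl⟩)
  · rw [(mem_cyclicCode_iff hβ).mp hc j hj, zero_smul]
    exact zero_mem _

lemma mem_cyclicCode_of_mem_span {I : Set (ZMod n)} {c : Fin n → F}
    (hc : extendScalars F (AlgebraicClosure F) (Fin n) c ∈ Submodule.span (AlgebraicClosure F)
      (charVector (AddChar.zmodChar n hβ.pow_eq_one) '' I)) :
    c ∈ cyclicCode F n β I := by
  rw [mem_cyclicCode_iff hβ]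
  intro j hj
  generalize extendScalars F (AlgebraicClosure F) (Fin n) c = w at hc ⊢
  induction hc using Submodule.span_induction with
  | mem x hx =>
    obtain ⟨a, ha, rfl⟩ := hx
    rw [sum_charVector_mul (AddChar.zmodChar_primitive_of_primitive_root n hβ),
      if_neg fun h : a = j => hj (h ▸ ha)]
  | zero => simp
  | add x y _ _ hx hy => simp only [Pi.add_apply, add_mul, Finset.sum_add_distrib, hx, hy, add_zero]
  | smul r x _ hx =>
    simp only [Pi.smul_apply, smul_eq_mul, mul_assoc, ← Finset.mul_sum, hx, mul_zero]

/-- Each `charVector` with frequency in `I` is a combination of traces, which are codewords. -/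
lemma charVector_mem_span_cyclicCode [Fintype F] {I : Set (ZMod n)}
    (hI : ∀ a ∈ I, (Fintype.card F : ZMod n) * a ∈ I) {a : ZMod n} (ha : a ∈ I) :
    charVector (AddChar.zmodChar n hβ.pow_eq_one) a ∈ Submodule.span (AlgebraicClosure F)
      (extendScalars F (AlgebraicClosure F) (Fin n) '' (cyclicCode F n β I : Set (Fin n → F))) := by
  classical
  set ψ := AddChar.zmodChar n hβ.pow_eq_one with hψ
  let K := IntermediateField.adjoin F {β}
  have : FiniteDimensional F K :=
    IntermediateField.adjoin.finiteDimensional (Algebra.IsIntegral.isIntegral β)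
  have : Finite K := Module.finite_of_finite F
  let γ : K := ⟨β, IntermediateField.mem_adjoin_simple_self F β⟩
  let u : Fin n → K := fun k => γ ^ (-(a * (k : ZMod n))).val
  have hu : ∀ k, algebraMap K (AlgebraicClosure F) (u k) = charVector ψ a k := fun k => by
    simp [u, γ, charVector, hψ, AddChar.zmodChar_apply]
  have hmem : ∀ i : ℕ, (Nat.card F ^ i : ℕ) * a ∈ I := by
    intro i
    induction i with
    | zero => simpa using ha
    | succ i ih =>
      have := hI _ ih
      rwa [← mul_assoc, ← Nat.cast_mul, ← Nat.card_eq_fintype_card, ← pow_succ'] at this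
  have hcode : ∀ t : K, (fun k => Algebra.trace F K (u k * t)) ∈ cyclicCode F n β I := by
    intro t
    refine mem_cyclicCode_of_mem_span hβ ?_
    have key : extendScalars F (AlgebraicClosure F) (Fin n)
          (fun k => Algebra.trace F K (u k * t)) =
        ∑ i ∈ Finset.range (Module.finrank F K),
          (algebraMap K (AlgebraicClosure F) t ^ Nat.card F ^ i) •
            charVector ψ ((Nat.card F ^ i : ℕ) * a) := by
      ext k
      simp only [RingHom.compLeft_apply, Function.comp_apply, Finset.sum_apply, Pi.smul_apply,
        smul_eq_mul]
      rw [IsScalarTower.algebraMap_apply F K (AlgebraicClosure F),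
        FiniteField.algebraMap_trace_eq_sum_pow, map_sum]
      refine Finset.sum_congr rfl fun i _ => ?_
      rw [map_pow, map_mul, hu, mul_pow, mul_comm]
      congr 1
      simp only [charVector]
      rw [← AddChar.map_nsmul_eq_pow, nsmul_eq_mul]
      congr 1
      ring
    rw [key]
    exact Submodule.sum_mem _ fun i _ =>
      Submodule.smul_mem _ _ (Submodule.subset_span ⟨_, hmem i, rfl⟩)
  let b := Module.finBasis F K
  have hexp : charVector ψ a = ∑ i, algebraMap K (AlgebraicClosure F) (b.traceDual i) •
      extendScalars F (AlgebraicClosure F) (Fin n) (fun k => Algebra.trace F K (u k * b i)) := by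
    ext k
    rw [← hu]
    conv_lhs => rw [← b.traceDual.sum_repr (u k)]
    simp only [map_sum, Finset.sum_apply, Module.Basis.traceDual_repr_apply,
      Algebra.traceForm_apply,
      Algebra.smul_def, map_mul, ← IsScalarTower.algebraMap_apply F K (AlgebraicClosure F)]
    exact Finset.sum_congr rfl fun i _ => mul_comm _ _
  rw [hexp]
  exact Submodule.sum_mem _ fun i _ =>
    Submodule.smul_mem _ _ (Submodule.subset_span ⟨_, hcode _, rfl⟩)

end Codes

/-- For unions `I_1, I_2` of `q`-cyclotomic cosets modulo `n`
(`gcd(n,q)=1`), the Schur product of the cyclic codes `C(I_1)` and `C(I_2)` is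
`C(I_1 + I_2)`, where `I_1 + I_2 = {a + b mod n}`. -/
theorem cyclicCode_schurProd
    {F : Type*} [Field F] [Fintype F] {n : ℕ} [NeZero n]
    (hn : Nat.Coprime n (Fintype.card F))
    (β : AlgebraicClosure F) (hβ : IsPrimitiveRoot β n)
    (I₁ I₂ : Set (ZMod n))
    (hI₁ : ∀ a ∈ I₁, (Fintype.card F : ZMod n) * a ∈ I₁)
    (hI₂ : ∀ a ∈ I₂, (Fintype.card F : ZMod n) * a ∈ I₂) :
    schurProd (cyclicCode F n β I₁) (cyclicCode F n β I₂) = cyclicCode F n β (I₁ + I₂) := by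
  refine le_antisymm (Submodule.span_le.mpr ?_) fun c hc => ?_
  · rintro _ ⟨c, hc, c', hc', rfl⟩
    refine mem_cyclicCode_of_mem_span hβ ?_
    have h := Submodule.mul_mem_mul (cyclicCode_mem_span_charVector hβ hc)
      (cyclicCode_mem_span_charVector hβ hc')
    rw [Submodule.span_mul_span, ← map_mul] at h
    refine Submodule.span_mono ?_ h
    rintro _ ⟨_, ⟨a, ha, rfl⟩, _, ⟨b, hb, rfl⟩, rfl⟩
    exact ⟨a + b, Set.add_mem_add ha hb, charVector_add _ a b⟩
  · refine mem_of_extendScalars_mem_span _ (Submodule.span_le.mpr ?_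
      (cyclicCode_mem_span_charVector hβ hc))
    rintro _ ⟨_, ⟨a, ha, b, hb, rfl⟩, rfl⟩
    dsimp only
    rw [charVector_add]
    exact mul_mem_span_schurProd (charVector_mem_span_cyclicCode hβ hI₁ ha)
      (charVector_mem_span_cyclicCode hβ hI₂ hb)
end

section
/- Let n be coprime to q, let β be a primitive n-th root of unity in an algebraic closure of F_q, and let 𝔉 = F_q(β). For M ⊆ Z/nZ let B(M) ⊆ 𝔉^n be the code {(f(1), f(β), ..., f(β^{n−1})) : f ∈ P(M)}, where P(M) is the 𝔉-span of the monomials X^i with i ∈ M. Then for any q-cyclotomic cosets (or unions thereof) I_1, I_2 ⊆ Z/nZ, the componentwise product satisfies B(−I_1) * B(−I_2) = B(−(I_1 + I_2)), where I_1 + I_2 = {a + b mod n : a ∈ I_1, b ∈ I_2} and −I = {−i mod n : i ∈ I}. -/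
open scoped Pointwise

/-- The evaluation code `B(M)`: evaluations at `1, β, …, β^{n-1}` of the span of
the monomials `X^i`, `i ∈ M` (so the word for `X^i` has `k`-th entry `β^{ik}`). -/
noncomputable def evalCode {E : Type*} [Field E] (n : ℕ) [NeZero n] (β : E)
    (M : Set (ZMod n)) : Submodule E (Fin n → E) :=
  Submodule.span E {v | ∃ i ∈ M, v = fun k : Fin n => β ^ (i * (k : ZMod n)).val}

/-- The words of `X^i` and `X^j` multiply componentwise to the word of `X^(i+j)`, exponents being
taken modulo `n`. -/
theorem pow_val_add_mul {E : Type*} [Field E] {n : ℕ} [NeZero n] {β : E} (hβ : β ^ n = 1)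
    (i j k : ZMod n) :
    β ^ ((i + j) * k).val = β ^ (i * k).val * β ^ (j * k).val := by
  rw [add_mul, ZMod.val_add, ← pow_add, ← pow_eq_pow_mod _ hβ]

/-- The Schur product of evaluation codes is the evaluation code of the sumset. -/
theorem schurProd_evalCode {E : Type*} [Field E] {n : ℕ} [NeZero n] {β : E} (hβ : β ^ n = 1)
    (M₁ M₂ : Set (ZMod n)) :
    schurProd (evalCode n β M₁) (evalCode n β M₂) = evalCode n β (M₁ + M₂) := by
  apply le_antisymm
  · refine Submodule.span_le.mpr ?_
    rintro _ ⟨c, hc, c', hc', rfl⟩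
    have h := Submodule.mul_mem_mul hc hc'
    rw [evalCode, evalCode, Submodule.span_mul_span] at h
    refine Submodule.span_mono ?_ h
    rintro _ ⟨_, ⟨i, hi, rfl⟩, _, ⟨j, hj, rfl⟩, rfl⟩
    exact ⟨i + j, Set.add_mem_add hi hj, funext fun k => (pow_val_add_mul hβ i j k).symm⟩
  · refine Submodule.span_le.mpr ?_
    rintro _ ⟨_, ⟨i, hi, j, hj, rfl⟩, rfl⟩
    exact Submodule.subset_span ⟨_, Submodule.subset_span ⟨i, hi, rfl⟩,
      _, Submodule.subset_span ⟨j, hj, rfl⟩, funext fun k => pow_val_add_mul hβ i j k⟩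

/-- Let `F_q(β)` where `β` is a primitive `n`-th root of unity
(`gcd(n,q)=1`). For unions `I_1, I_2` of `q`-cyclotomic cosets modulo `n`, the
evaluation codes satisfy `B(-I_1) * B(-I_2) = B(-(I_1 + I_2))`. -/
theorem evalCode_schurProd
    {F E : Type*} [Field F] [Fintype F] [Field E] [Algebra F E] {n : ℕ} [NeZero n]
    (hn : Nat.Coprime n (Fintype.card F))
    (β : E) (hβ : IsPrimitiveRoot β n)
    (hE : IntermediateField.adjoin F {β} = ⊤)
    (I₁ I₂ : Set (ZMod n))
    (hI₁ : ∀ a ∈ I₁, (Fintype.card F : ZMod n) * a ∈ I₁)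
    (hI₂ : ∀ a ∈ I₂, (Fintype.card F : ZMod n) * a ∈ I₂) :
    schurProd (evalCode n β (-I₁)) (evalCode n β (-I₂)) = evalCode n β (-(I₁ + I₂)) := by
  rw [schurProd_evalCode hβ.pow_eq_one, neg_add]
end

section
/- Let C_0, C_1, ..., C_{s−1} ⊆ F_q^n be linear codes, let α_1, ..., α_{q−1} be the distinct nonzero elements of F_q, let s ≤ q−1 be a positive integer, and let V_q(s) be the s×(q−1) Vandermonde matrix whose (i,j) entry is α_j^{i−1}. Set C = [C_0, C_1, ..., C_{s−1}]V_q(s) and s̃ = min{2s−1, q−1}. Then C^{*2} = [D_0, D_1, ..., D_{s̃−1}]V_q(s̃), where for each l, D_l = Σ_{i+j ≡ l (mod q−1), 0 ≤ i,j ≤ s−1} C_i * C_j. -/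
open scoped Pointwise

/-- The tensor map `x ↦ a ⊗ x`, placing the multiple `a j • x` of `x` in the `j`-th block. -/
def blockScale {F : Type*} [Field F] {n l : ℕ} (a : Fin l → F) :
    (Fin n → F) →ₗ[F] (Fin l × Fin n → F) where
  toFun x jk := a jk.1 * x jk.2
  map_add' x y := by
    funext jk
    simp [mul_add]
  map_smul' r x := by
    funext jk
    simp [mul_left_comm]

theorem matrixProdCode_eq_iSup {F : Type*} [Field F] {n s l : ℕ}
    (C : Fin s → Submodule F (Fin n → F)) (A : Matrix (Fin s) (Fin l) F) :
    matrixProdCode C A = ⨆ i, (C i).map (blockScale (A i)) := by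
  apply le_antisymm
  · rintro _ ⟨c, hc, rfl⟩
    have hsum : (∑ i, blockScale (A i) (c i)) ∈ ⨆ i, (C i).map (blockScale (A i)) :=
      Submodule.sum_mem _ fun i _ =>
        Submodule.mem_iSup_of_mem i (Submodule.mem_map_of_mem (hc i trivial))
    convert hsum using 1
    funext jk
    simp [blockScale]
  · refine iSup_le fun i => ?_
    rintro _ ⟨x, hx, rfl⟩
    refine ⟨Pi.single i x, fun j _ => ?_, ?_⟩
    · rcases eq_or_ne j i with rfl | hji
      · simpa using hx
      · simp [hji]
    · funext jk
      change ∑ j, A j jk.1 * (Pi.single i x : Fin s → Fin n → F) j jk.2 = A i jk.1 * x jk.2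
      rw [Finset.sum_eq_single i (fun j _ hji => by simp [hji]) (by simp)]
      simp

theorem schurProd_eq_mul {F : Type*} [Field F] {ι : Type*} (C C' : Submodule F (ι → F)) :
    schurProd C C' = C * C' := by
  rw [Submodule.mul_eq_span_mul_set, schurProd]
  congr 1
  ext x
  simp [Set.mem_mul, eq_comm]

theorem map_blockScale_mul {F : Type*} [Field F] {n l : ℕ} (a b : Fin l → F)
    (C C' : Submodule F (Fin n → F)) :
    C.map (blockScale a) * C'.map (blockScale b) = (C * C').map (blockScale (a * b)) := by
  have key (x y : Fin n → F) :
      blockScale a x * blockScale b y = blockScale (a * b) (x * y) := by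
    funext jk
    exact mul_mul_mul_comm _ _ _ _
  apply le_antisymm
  · rw [Submodule.mul_le]
    rintro _ ⟨x, hx, rfl⟩ _ ⟨y, hy, rfl⟩
    rw [key]
    exact Submodule.mem_map_of_mem (Submodule.mul_mem_mul hx hy)
  · rw [Submodule.map_le_iff_le_comap, Submodule.mul_le]
    intro x hx y hy
    rw [Submodule.mem_comap, ← key]
    exact Submodule.mul_mem_mul (Submodule.mem_map_of_mem hx) (Submodule.mem_map_of_mem hy)

/-- Let `V_q(s)` be the `s × (q-1)` Vandermonde matrix built from the
distinct nonzero elements `α_j` of `F_q`, and `C = [C_0,…,C_{s-1}]V_q(s)`. With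
`s̃ = min{2s-1, q-1}` one has `C^{*2} = [D_0,…,D_{s̃-1}]V_q(s̃)` where
`D_l = ∑_{i+j ≡ l (mod q-1)} C_i * C_j`. -/
theorem vandermonde_square
    {F : Type*} [Field F] [Fintype F] {n s : ℕ}
    (hs : 0 < s) (hsq : s ≤ Fintype.card F - 1)
    (α : Fin (Fintype.card F - 1) → F)
    (hαinj : Function.Injective α) (hα0 : ∀ j, α j ≠ 0)
    (C : Fin s → Submodule F (Fin n → F)) :
    schurProd
        (matrixProdCode C
          (Matrix.of fun (i : Fin s) (j : Fin (Fintype.card F - 1)) => α j ^ (i : ℕ)))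
        (matrixProdCode C
          (Matrix.of fun (i : Fin s) (j : Fin (Fintype.card F - 1)) => α j ^ (i : ℕ))) =
      matrixProdCode
        (fun l : Fin (min (2 * s - 1) (Fintype.card F - 1)) =>
          ⨆ (p : Fin s × Fin s)
            (_ : ((p.1 : ℕ) + (p.2 : ℕ)) % (Fintype.card F - 1) = (l : ℕ)),
            schurProd (C p.1) (C p.2))
        (Matrix.of fun (i : Fin (min (2 * s - 1) (Fintype.card F - 1)))
            (j : Fin (Fintype.card F - 1)) => α j ^ (i : ℕ)) := by
  have hpow (m : ℕ) : (fun j => α j ^ (m % (Fintype.card F - 1))) = fun j => α j ^ m := by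
    funext j
    exact (pow_eq_pow_mod m (FiniteField.pow_card_sub_one_eq_one (α j) (hα0 j))).symm
  have hmul (i j : ℕ) : ((fun k => α k ^ i) * fun k => α k ^ j) =
      fun k => α k ^ ((i + j) % (Fintype.card F - 1)) := by
    rw [hpow]
    funext k
    exact (pow_add _ _ _).symm
  simp only [schurProd_eq_mul, matrixProdCode_eq_iSup, Submodule.iSup_mul, Submodule.mul_iSup,
    map_blockScale_mul, Submodule.map_iSup]
  apply le_antisymm
  · refine iSup_le fun j => iSup_le fun i => ?_
    have hlt : ((i : ℕ) + j) % (Fintype.card F - 1) < min (2 * s - 1) (Fintype.card F - 1) :=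
      lt_min ((Nat.mod_le _ _).trans_lt (by omega)) (Nat.mod_lt _ (by omega))
    refine le_iSup_of_le ⟨_, hlt⟩ (le_iSup_of_le (i, j) (le_iSup_of_le rfl ?_))
    exact (congrArg (fun a => (C i * C j).map (blockScale a)) (hmul i j)).le
  · refine iSup_le fun l => iSup_le fun p => iSup_le fun hp => ?_
    refine le_iSup_of_le p.2 (le_iSup_of_le p.1 ?_)
    refine (congrArg (fun a => (C p.1 * C p.2).map (blockScale a)) ?_).le
    exact .trans (by rw [hp]; rfl) (hmul p.1 p.2).symm
end
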